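/- For every τ ∈ [0, 1), the heat evolution operator on ℝⁿ at time τ, given by convolution with the Gaussian kernel [4π(τ+1)]^{−n/2} exp(−‖x−y‖²/(4(τ+1))) applied to initial data at time −1, is a bounded linear operator from L²(ℝⁿ, e^{−‖y‖²/4} dy) to L²(ℝⁿ, e^{−‖x‖²/(2(1−τ))} dx). -/

import Mathlib

open MeasureTheory Real

lemma gauss_lint (n : ℕ) (b : ℝ) (hb : 0 < b) :
    ∫⁻ x : EuclideanSpace ℝ (Fin n), ENNReal.ofReal (Real.exp (-b * ‖x‖ ^ 2)) ≠ ⊤ := by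
  have h := GaussianFourier.integral_rexp_neg_mul_sq_norm (V := EuclideanSpace ℝ (Fin n)) hb
  have hi : Integrable (fun x : EuclideanSpace ℝ (Fin n) => Real.exp (-b * ‖x‖ ^ 2)) := by
    by_contra hc
    rw [integral_undef hc] at h
    have : 0 < (π / b) ^ (Module.finrank ℝ (EuclideanSpace ℝ (Fin n)) / 2 : ℝ) := by positivity
    linarith
  rw [← ofReal_integral_eq_lintegral_ofReal hi (Filter.Eventually.of_forall fun _ => (Real.exp_pos _).le)]
  exact ENNReal.ofReal_ne_top

lemma cs_sq {α : Type*} [MeasurableSpace α] (μ : Measure α) (H V : α → ENNReal)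
    (hH : Measurable H) (hV : Measurable V) :
    (∫⁻ y, H y * V y ∂μ) ^ 2 ≤ (∫⁻ y, H y ^ 2 ∂μ) * ∫⁻ y, V y ^ 2 ∂μ := by
  have h := ENNReal.lintegral_mul_le_Lp_mul_Lq μ (p := 2) (q := 2)
    (by constructor <;> norm_num) hH.aemeasurable hV.aemeasurable
  have h2 := pow_le_pow_left' h 2
  rw [mul_pow] at h2
  have e : ∀ a : ENNReal, (a ^ (1 / 2 : ℝ)) ^ 2 = a := fun a => by
    rw [← ENNReal.rpow_natCast, ← ENNReal.rpow_mul]; norm_num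
  rw [e, e] at h2
  simpa using h2

/-- the heat kernel -/
noncomputable def kk (n : ℕ) (τ : ℝ) (x y : EuclideanSpace ℝ (Fin n)) : ℝ :=
  (4 * π * (τ + 1)) ^ (-(n : ℝ) / 2) * Real.exp (-‖x - y‖ ^ 2 / (4 * (τ + 1)))

noncomputable def HH (n : ℕ) (τ : ℝ) (x y : EuclideanSpace ℝ (Fin n)) : ENNReal :=
  ENNReal.ofReal (Real.exp (-((1 - τ) / (16 * (1 + τ))) * ‖y - (2 / (1 - τ)) • x‖ ^ 2))

lemma kk_meas (n : ℕ) (τ : ℝ) : Measurable (Function.uncurry (kk n τ)) := by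
  unfold kk Function.uncurry
  fun_prop

lemma HH_meas (n : ℕ) (τ : ℝ) : Measurable (Function.uncurry (HH n τ)) := by
  unfold HH Function.uncurry
  fun_prop

lemma HH_sq (n : ℕ) (τ : ℝ) (x y : EuclideanSpace ℝ (Fin n)) :
    HH n τ x y ^ 2 =
      ENNReal.ofReal (Real.exp (-((1 - τ) / (8 * (1 + τ))) * ‖y - (2 / (1 - τ)) • x‖ ^ 2)) := by
  unfold HH
  rw [← ENNReal.ofReal_pow (Real.exp_pos _).le, ← Real.exp_nat_mul]
  congr 2
  push_cast
  rw [show (16 * (1 + τ)) = 2 * (8 * (1 + τ)) by ring, ← div_div, div_right_comm]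
  ring

lemma HH_le_one (n : ℕ) (τ : ℝ) (hτ₀ : 0 ≤ τ) (hτ₁ : τ < 1) (x y : EuclideanSpace ℝ (Fin n)) :
    HH n τ x y ≤ 1 := by
  unfold HH
  rw [ENNReal.ofReal_le_one, Real.exp_le_one_iff]
  have : 0 < 1 - τ := by linarith
  have : 0 ≤ ((1 - τ) / (16 * (1 + τ))) * ‖y - (2 / (1 - τ)) • x‖ ^ 2 := by positivity
  linarith

lemma HH_int_y (n : ℕ) (τ : ℝ) (x : EuclideanSpace ℝ (Fin n)) :
    ∫⁻ y, HH n τ x y ^ 2 =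
      ∫⁻ y : EuclideanSpace ℝ (Fin n),
        ENNReal.ofReal (Real.exp (-((1 - τ) / (8 * (1 + τ))) * ‖y‖ ^ 2)) := by
  simp_rw [HH_sq]
  exact lintegral_sub_right_eq_self
    (fun y => ENNReal.ofReal (Real.exp (-((1 - τ) / (8 * (1 + τ))) * ‖y‖ ^ 2))) _

lemma HH_int_x (n : ℕ) (τ : ℝ) (hτ₁ : τ < 1) (y : EuclideanSpace ℝ (Fin n)) :
    ∫⁻ x, HH n τ x y ^ 2 =
      ∫⁻ x : EuclideanSpace ℝ (Fin n), ENNReal.ofReal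
        (Real.exp (-((1 - τ) / (8 * (1 + τ)) * (2 / (1 - τ)) ^ 2) * ‖x‖ ^ 2)) := by
  simp_rw [HH_sq]
  have h1 : 0 < 1 - τ := by linarith
  refine Eq.trans ?_ (lintegral_sub_right_eq_self (fun x : EuclideanSpace ℝ (Fin n) =>
    ENNReal.ofReal (Real.exp (-((1 - τ) / (8 * (1 + τ)) * (2 / (1 - τ)) ^ 2) * ‖x‖ ^ 2)))
    (((1 - τ) / 2) • y))
  refine lintegral_congr fun x => ?_
  congr 2
  have : y - (2 / (1 - τ)) • x = -((2 / (1 - τ)) • (x - ((1 - τ) / 2) • y)) := by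
    rw [smul_sub, smul_smul, show 2 / (1 - τ) * ((1 - τ) / 2) = 1 by field_simp]
    simp
  rw [this, norm_neg, norm_smul, mul_pow, Real.norm_eq_abs, sq_abs]
  ring

lemma kk_eq (n : ℕ) (τ : ℝ) (hτ₀ : 0 ≤ τ) (hτ₁ : τ < 1) (x y : EuclideanSpace ℝ (Fin n)) :
    ‖kk n τ x y‖ₑ = ENNReal.ofReal ((4 * π * (τ + 1)) ^ (-(n : ℝ) / 2))
      * ENNReal.ofReal (Real.exp (‖x‖ ^ 2 / (4 * (1 - τ))))
      * (HH n τ x y ^ 2 * ENNReal.ofReal (Real.exp (-‖y‖ ^ 2 / 8))) := by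
  have h1 : 0 < 1 - τ := by linarith
  rw [HH_sq, ← ENNReal.ofReal_mul (by positivity), ← ENNReal.ofReal_mul (by positivity),
    ← ENNReal.ofReal_mul (by positivity), Real.enorm_of_nonneg (by unfold kk; positivity)]
  congr 1
  unfold kk
  rw [← Real.exp_add, mul_assoc (_ ^ _) (Real.exp _), ← Real.exp_add]
  congr 2
  rw [norm_sub_sq_real, norm_sub_sq_real, norm_smul, inner_smul_right, mul_pow, Real.norm_eq_abs,
    sq_abs, real_inner_comm]
  generalize inner ℝ y x = s
  generalize ‖x‖ = a
  generalize ‖y‖ = b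
  have h2 : τ + 1 ≠ 0 := by positivity
  have h3 : 1 + τ ≠ 0 := by positivity
  field_simp
  ring

/-- weighted density -/
noncomputable def UU (n : ℕ) (f : EuclideanSpace ℝ (Fin n) → ℝ) (y : EuclideanSpace ℝ (Fin n)) :
    ENNReal := ENNReal.ofReal (Real.exp (-‖y‖ ^ 2 / 8)) * ‖f y‖ₑ

lemma UU_sq (n : ℕ) (f : EuclideanSpace ℝ (Fin n) → ℝ) (y : EuclideanSpace ℝ (Fin n)) :
    UU n f y ^ 2 = ENNReal.ofReal (Real.exp (-‖y‖ ^ 2 / 4)) * ‖f y‖ₑ ^ 2 := by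
  unfold UU
  rw [mul_pow, ← ENNReal.ofReal_pow (Real.exp_pos _).le, ← Real.exp_nat_mul]
  congr 3
  push_cast
  ring

lemma UU_meas (n : ℕ) (f : EuclideanSpace ℝ (Fin n) → ℝ) (hf : Measurable f) :
    Measurable (UU n f) := by
  unfold UU
  fun_prop

lemma lint_eq (n : ℕ) (τ : ℝ) (hτ₀ : 0 ≤ τ) (hτ₁ : τ < 1)
    (f : EuclideanSpace ℝ (Fin n) → ℝ) (hf : Measurable f) (x : EuclideanSpace ℝ (Fin n)) :
    ∫⁻ y, ‖kk n τ x y * f y‖ₑ = ENNReal.ofReal ((4 * π * (τ + 1)) ^ (-(n : ℝ) / 2))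
      * ENNReal.ofReal (Real.exp (‖x‖ ^ 2 / (4 * (1 - τ))))
      * ∫⁻ y, HH n τ x y * (HH n τ x y * UU n f y) := by
  have hH : Measurable (HH n τ x) := (HH_meas n τ).of_uncurry_left
  have hm : Measurable fun y => HH n τ x y * (HH n τ x y * UU n f y) :=
    hH.mul (hH.mul (UU_meas n f hf))
  rw [← lintegral_const_mul _ hm]
  refine lintegral_congr fun y => ?_
  rw [enorm_mul, kk_eq n τ hτ₀ hτ₁, UU]
  ring

lemma lint_sq (n : ℕ) (τ : ℝ)
    (f : EuclideanSpace ℝ (Fin n) → ℝ) (hf : Measurable f) (x : EuclideanSpace ℝ (Fin n)) :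
    (∫⁻ y, HH n τ x y * (HH n τ x y * UU n f y)) ^ 2 ≤
      (∫⁻ y : EuclideanSpace ℝ (Fin n),
        ENNReal.ofReal (Real.exp (-((1 - τ) / (8 * (1 + τ))) * ‖y‖ ^ 2))) *
      ∫⁻ y, HH n τ x y ^ 2 * UU n f y ^ 2 := by
  have hH : Measurable (HH n τ x) := (HH_meas n τ).of_uncurry_left
  refine (cs_sq _ _ _ hH (hH.mul (UU_meas n f hf))).trans ?_
  rw [HH_int_y]
  simp_rw [Pi.mul_apply, mul_pow]
  exact le_rfl

lemma kk_integrable (n : ℕ) (τ : ℝ) (hτ₀ : 0 ≤ τ) (hτ₁ : τ < 1)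
    (f : EuclideanSpace ℝ (Fin n) → ℝ) (hf : Measurable f)
    (hN : ∫⁻ y, UU n f y ^ 2 ≠ ⊤) (x : EuclideanSpace ℝ (Fin n)) :
    Integrable (fun y => kk n τ x y * f y) := by
  have h1 : 0 < 1 - τ := by linarith
  refine ⟨((kk_meas n τ).of_uncurry_left.mul hf).aestronglyMeasurable, ?_⟩
  rw [hasFiniteIntegral_iff_enorm, lint_eq n τ hτ₀ hτ₁ f hf]
  refine ENNReal.mul_lt_top (ENNReal.mul_lt_top ENNReal.ofReal_lt_top ENNReal.ofReal_lt_top) ?_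
  have h := lint_sq n τ f hf x
  have h2 : ∫⁻ y, HH n τ x y ^ 2 * UU n f y ^ 2 ≤ ∫⁻ y, UU n f y ^ 2 := by
    refine lintegral_mono fun y => ?_
    exact mul_le_of_le_one_left' (pow_le_one' (HH_le_one n τ hτ₀ hτ₁ x y) 2)
  have h3 := ENNReal.mul_lt_top (gauss_lint n ((1 - τ) / (8 * (1 + τ))) (by positivity)).lt_top
    (h2.trans_lt hN.lt_top)
  have h4 := h.trans_lt h3
  by_contra hc
  rw [not_lt, top_le_iff] at hc
  rw [hc] at h4
  simp at h4

lemma main_bound (n : ℕ) (τ : ℝ) (hτ₀ : 0 ≤ τ) (hτ₁ : τ < 1) :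
    ∃ C : ENNReal, C ≠ ⊤ ∧ ∀ f : EuclideanSpace ℝ (Fin n) → ℝ, Measurable f →
      ∫⁻ x, ENNReal.ofReal (Real.exp (-‖x‖ ^ 2 / (2 * (1 - τ)))) * ‖∫ y, kk n τ x y * f y‖ₑ ^ 2
        ≤ C * ∫⁻ y, UU n f y ^ 2 := by
  have h1 : 0 < 1 - τ := by linarith
  set c := ENNReal.ofReal ((4 * π * (τ + 1)) ^ (-(n : ℝ) / 2)) with hc
  set I := ∫⁻ y : EuclideanSpace ℝ (Fin n),
        ENNReal.ofReal (Real.exp (-((1 - τ) / (8 * (1 + τ))) * ‖y‖ ^ 2)) with hI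
  set J := ∫⁻ x : EuclideanSpace ℝ (Fin n), ENNReal.ofReal
        (Real.exp (-((1 - τ) / (8 * (1 + τ)) * (2 / (1 - τ)) ^ 2) * ‖x‖ ^ 2)) with hJ
  have hIt : I ≠ ⊤ := gauss_lint n _ (by positivity)
  have hJt : J ≠ ⊤ := gauss_lint n _ (by positivity)
  refine ⟨c ^ 2 * I * J, ENNReal.mul_ne_top (ENNReal.mul_ne_top
    (ENNReal.pow_ne_top ENNReal.ofReal_ne_top) hIt) hJt, fun f hf => ?_⟩
  have hU := UU_meas n f hf
  have hm : Measurable (Function.uncurry fun x y => HH n τ x y ^ 2 * UU n f y ^ 2) :=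
    ((HH_meas n τ).pow_const 2).mul ((hU.comp measurable_snd).pow_const 2)
  calc _ ≤ ∫⁻ x, c ^ 2 * I * ∫⁻ y, HH n τ x y ^ 2 * UU n f y ^ 2 := by
        refine lintegral_mono fun x => ?_
        have e1 := enorm_integral_le_lintegral_enorm (μ := volume) (fun y => kk n τ x y * f y)
        rw [lint_eq n τ hτ₀ hτ₁ f hf] at e1
        have e2 := pow_le_pow_left' e1 2
        have e3 := lint_sq n τ f hf x
        have e4 : ENNReal.ofReal (Real.exp (-‖x‖ ^ 2 / (2 * (1 - τ)))) *
            ENNReal.ofReal (Real.exp (‖x‖ ^ 2 / (4 * (1 - τ)))) ^ 2 = 1 := by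
          rw [← ENNReal.ofReal_pow (Real.exp_pos _).le, ← Real.exp_nat_mul,
            ← ENNReal.ofReal_mul (Real.exp_pos _).le, ← Real.exp_add]
          rw [show -‖x‖ ^ 2 / (2 * (1 - τ)) + (2 : ℕ) * (‖x‖ ^ 2 / (4 * (1 - τ))) = 0 by
            push_cast; field_simp; ring]
          simp
        rw [mul_pow, mul_pow] at e2
        calc _ ≤ _ := mul_le_mul_right e2 _
          _ = (ENNReal.ofReal (Real.exp (-‖x‖ ^ 2 / (2 * (1 - τ)))) *
            ENNReal.ofReal (Real.exp (‖x‖ ^ 2 / (4 * (1 - τ)))) ^ 2) * (c ^ 2 *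
              (∫⁻ y, HH n τ x y * (HH n τ x y * UU n f y)) ^ 2) := by ring
          _ ≤ c ^ 2 * (I * ∫⁻ y, HH n τ x y ^ 2 * UU n f y ^ 2) := by
            rw [e4, one_mul]; exact mul_le_mul_right e3 _
          _ = _ := by ring
    _ = c ^ 2 * I * ∫⁻ x, ∫⁻ y, HH n τ x y ^ 2 * UU n f y ^ 2 :=
        lintegral_const_mul _ hm.lintegral_prod_right
    _ = c ^ 2 * I * ∫⁻ y, J * UU n f y ^ 2 := by
        rw [lintegral_lintegral_swap hm.aemeasurable]
        congr 1
        refine lintegral_congr fun y => ?_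
        rw [lintegral_mul_const _ ((HH_meas n τ).of_uncurry_right.pow_const 2), HH_int_x n τ hτ₁]
    _ = _ := by
        rw [lintegral_const_mul _ (hU.pow_const 2)]; ring

lemma eLp_sq {α : Type*} [MeasurableSpace α] (μ : Measure α) (w : α → ℝ) (hw : Measurable w)
    (f : α → ℝ) (hf : Measurable f) :
    eLpNorm f 2 (μ.withDensity fun x => ENNReal.ofReal (w x)) ^ 2 =
      ∫⁻ x, ENNReal.ofReal (w x) * ‖f x‖ₑ ^ 2 ∂μ := by
  have h := eLpNorm_nnreal_pow_eq_lintegral (f := f) (p := 2)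
    (μ := μ.withDensity fun x => ENNReal.ofReal (w x)) two_ne_zero
  simp only [NNReal.coe_ofNat, ENNReal.coe_ofNat, ENNReal.rpow_ofNat] at h
  rw [h, lintegral_withDensity_eq_lintegral_mul _ (by fun_prop) (by fun_prop)]
  rfl

theorem stmt_5 (n : ℕ) (τ : ℝ) (hτ₀ : 0 ≤ τ) (hτ₁ : τ < 1) :
    ∃ T : Lp ℝ 2 ((volume : Measure (EuclideanSpace ℝ (Fin n))).withDensity
            (fun y => ENNReal.ofReal (Real.exp (-‖y‖ ^ 2 / 4)))) →L[ℝ]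
          Lp ℝ 2 ((volume : Measure (EuclideanSpace ℝ (Fin n))).withDensity
            (fun x => ENNReal.ofReal (Real.exp (-‖x‖ ^ 2 / (2 * (1 - τ)))))),
      ∀ f, (T f : EuclideanSpace ℝ (Fin n) → ℝ)
          =ᵐ[(volume : Measure (EuclideanSpace ℝ (Fin n))).withDensity
              (fun x => ENNReal.ofReal (Real.exp (-‖x‖ ^ 2 / (2 * (1 - τ)))))]
        fun x => ∫ y : EuclideanSpace ℝ (Fin n),
          (4 * π * (τ + 1)) ^ (-(n : ℝ) / 2)
            * Real.exp (-‖x - y‖ ^ 2 / (4 * (τ + 1))) * f y := by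
  change ∃ T : Lp ℝ 2 ((volume : Measure (EuclideanSpace ℝ (Fin n))).withDensity
            (fun y => ENNReal.ofReal (Real.exp (-‖y‖ ^ 2 / 4)))) →L[ℝ]
          Lp ℝ 2 ((volume : Measure (EuclideanSpace ℝ (Fin n))).withDensity
            (fun x => ENNReal.ofReal (Real.exp (-‖x‖ ^ 2 / (2 * (1 - τ)))))),
      ∀ f, (T f : EuclideanSpace ℝ (Fin n) → ℝ)
          =ᵐ[(volume : Measure (EuclideanSpace ℝ (Fin n))).withDensity
              (fun x => ENNReal.ofReal (Real.exp (-‖x‖ ^ 2 / (2 * (1 - τ)))))]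
        fun x => ∫ y : EuclideanSpace ℝ (Fin n), kk n τ x y * f y
  set μ := (volume : Measure (EuclideanSpace ℝ (Fin n))).withDensity
            (fun y => ENNReal.ofReal (Real.exp (-‖y‖ ^ 2 / 4))) with hμ
  set ν := (volume : Measure (EuclideanSpace ℝ (Fin n))).withDensity
            (fun x => ENNReal.ofReal (Real.exp (-‖x‖ ^ 2 / (2 * (1 - τ))))) with hν
  have hac : (volume : Measure (EuclideanSpace ℝ (Fin n))) ≪ μ := by
    refine withDensity_absolutelyContinuous' (by fun_prop) (Filter.Eventually.of_forall fun x => ?_)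
    simp [Real.exp_pos]
  have hmeas : ∀ f : Lp ℝ 2 μ, Measurable (f : EuclideanSpace ℝ (Fin n) → ℝ) :=
    fun f => (Lp.stronglyMeasurable f).measurable
  have hU : ∀ f : Lp ℝ 2 μ, ∫⁻ y, UU n f y ^ 2 = ‖f‖ₑ ^ 2 := fun f => by
    rw [Lp.enorm_def]
    refine Eq.trans ?_ (eLp_sq volume (fun y => Real.exp (-‖y‖ ^ 2 / 4)) (by fun_prop) _
      (hmeas f)).symm
    simp_rw [UU_sq]
  have hint : ∀ (f : Lp ℝ 2 μ) x, Integrable (fun y => kk n τ x y * f y) := fun f x =>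
    kk_integrable n τ hτ₀ hτ₁ f (hmeas f) (by rw [hU]; exact ENNReal.pow_ne_top (by simp)) x
  obtain ⟨C, hC, hb⟩ := main_bound n τ hτ₀ hτ₁
  let A : Lp ℝ 2 μ → EuclideanSpace ℝ (Fin n) → ℝ := fun f x => ∫ y, kk n τ x y * f y
  have hAm : ∀ f, StronglyMeasurable (A f) := fun f => by
    refine StronglyMeasurable.integral_prod_right (f := fun x y => kk n τ x y * f y) ?_
    exact ((kk_meas n τ).mul ((hmeas f).comp measurable_snd)).stronglyMeasurable
  have hAb : ∀ f, eLpNorm (A f) 2 ν ≤ (1 + C) * ‖f‖ₑ := fun f => by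
    have h := hb f (hmeas f)
    rw [hU] at h
    rw [← ENNReal.pow_le_pow_left_iff two_ne_zero, hν, eLp_sq _ _ (by fun_prop) _ (hAm f).measurable,
      mul_pow]
    refine h.trans (mul_le_mul_left ?_ _)
    calc C ≤ 1 + C := le_add_self
      _ ≤ (1 + C) ^ 2 := le_self_pow₀ le_self_add two_ne_zero
  have hC1 : 1 + C ≠ ⊤ := by simp [hC]
  have hAL : ∀ f, MemLp (A f) 2 ν := fun f => ⟨(hAm f).aestronglyMeasurable,
    (hAb f).trans_lt (ENNReal.mul_lt_top hC1.lt_top (by simp))⟩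
  have hadd : ∀ f g, A (f + g) = A f + A g := fun f g => by
    funext x
    simp only [A, Pi.add_apply]
    rw [← integral_add (hint f x) (hint g x)]
    refine integral_congr_ae ?_
    filter_upwards [hac.ae_le (Lp.coeFn_add f g)] with y hy
    rw [hy, Pi.add_apply, mul_add]
  have hsmul : ∀ (c : ℝ) f, A (c • f) = c • A f := fun c f => by
    funext x
    simp only [A, Pi.smul_apply, smul_eq_mul]
    rw [← integral_const_mul]
    refine integral_congr_ae ?_
    filter_upwards [hac.ae_le (Lp.coeFn_smul c f)] with y hy
    rw [hy, Pi.smul_apply, smul_eq_mul]; ring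
  let L : Lp ℝ 2 μ →ₗ[ℝ] Lp ℝ 2 ν :=
    { toFun := fun f => (hAL f).toLp
      map_add' := fun f g => by
        rw [← MemLp.toLp_add]; congr 1; exact hadd f g
      map_smul' := fun c f => by
        rw [RingHom.id_apply, ← MemLp.toLp_const_smul]; congr 1; exact hsmul c f }
  refine ⟨L.mkContinuous (1 + C).toReal fun f => ?_, fun f => ?_⟩
  · change ‖(hAL f).toLp‖ ≤ _
    rw [Lp.norm_toLp]
    have := ENNReal.toReal_mono (ENNReal.mul_ne_top hC1 (by simp)) (hAb f)
    simpa [ENNReal.toReal_mul] using this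
  · exact (hAL f).coeFn_toLp
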